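/- (Dehornoy) For all words a, b ∈ W, at least one of the following holds: a ≡ b, or there exist k ≥ 1 and words c_1,…,c_k ∈ W with ((a·c_1)·c_2)···c_k ≡ b, or there exist k ≥ 1 and words c_1,…,c_k ∈ W with ((b·c_1)·c_2)···c_k ≡ a. In other words, in the free monogenic left-distributive algebra W/≡, any two elements are comparable under ≡ or the left-subterm relation <_L. -/

import Mathlib

/-- The free magma on one generator: words built from `1` using `·`. -/
inductive W : Type
  | one : W
  | mul : W → W → W

/-- The smallest congruence on `W` containing all instances of the
left distributive law `a·(b·c) = (a·b)·(a·c)`. -/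
inductive LDEq : W → W → Prop
  | refl (a : W) : LDEq a a
  | symm {a b : W} : LDEq a b → LDEq b a
  | trans {a b c : W} : LDEq a b → LDEq b c → LDEq a c
  | congr {a a' b b' : W} : LDEq a a' → LDEq b b' → LDEq (a.mul b) (a'.mul b')
  | ld (a b c : W) : LDEq (a.mul (b.mul c)) ((a.mul b).mul (a.mul c))

/-- `Expands a b`: the word `b` is obtained from `a` by applying the left distributive law
to subwords, always from left to right. -/
inductive Expands : W → W → Prop
  | refl (a : W) : Expands a a
  | trans {a b c : W} : Expands a b → Expands b c → Expands a c
  | congr {a a' b b' : W} : Expands a a' → Expands b b' → Expands (a.mul b) (a'.mul b')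
  | ld (a b c : W) : Expands (a.mul (b.mul c)) ((a.mul b).mul (a.mul c))

theorem Expands.ldEq {a b : W} (h : Expands a b) : LDEq a b := by
  induction h with
  | refl a => exact .refl a
  | trans _ _ ih₁ ih₂ => exact ih₁.trans ih₂
  | congr _ _ ih₁ ih₂ => exact .congr ih₁ ih₂
  | ld a b c => exact .ld a b c

namespace W

/-- `a.distrib b` distributes `a` over all the leaves of `b`. -/
def distrib (a : W) : W → W
  | one => a.mul one
  | mul b c => (a.distrib b).mul (a.distrib c)

/-- Dehornoy's operator `∂`: a common expansion of all the words obtained from the given one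
by a single use of the left distributive law. -/
def derive : W → W
  | one => one
  | mul a b => a.derive.distrib b.derive

/-- The right power `1·(1·(⋯(1·1)))` with `n + 1` leaves. -/
def rightPow : ℕ → W
  | 0 => one
  | n + 1 => one.mul (rightPow n)

/-- `LeftSub a b`: the word `a` is an iterated left subword of `b`, possibly `b` itself. -/
inductive LeftSub (a : W) : W → Prop
  | refl : LeftSub a a
  | mul {b : W} (c : W) : LeftSub a b → LeftSub a (b.mul c)

theorem expands_distrib (a b : W) : Expands (a.mul b) (a.distrib b) := by
  induction b with
  | one => exact .refl _
  | mul b c ihb ihc => exact (Expands.ld a b c).trans (.congr ihb ihc)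

theorem expands_derive (a : W) : Expands a a.derive := by
  induction a with
  | one => exact .refl _
  | mul a b iha ihb => exact (Expands.congr iha ihb).trans (expands_distrib _ _)

theorem distrib_mono_left {a a' : W} (h : Expands a a') (b : W) :
    Expands (a.distrib b) (a'.distrib b) := by
  induction b with
  | one => exact .congr h (.refl _)
  | mul b c ihb ihc => exact .congr ihb ihc

theorem distrib_mono_right (a : W) {b b' : W} (h : Expands b b') :
    Expands (a.distrib b) (a.distrib b') := by
  induction h with
  | refl b => exact .refl _
  | trans _ _ ih₁ ih₂ => exact ih₁.trans ih₂
  | congr _ _ ih₁ ih₂ => exact .congr ih₁ ih₂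
  | ld b c d => exact .ld _ _ _

theorem distrib_distrib (a b c : W) :
    Expands (a.distrib (b.distrib c)) ((a.distrib b).distrib (a.distrib c)) := by
  induction c with
  | one => exact (Expands.ld _ _ _).trans (.congr (expands_distrib _ _) (.refl _))
  | mul c d ihc ihd => exact .congr ihc ihd

theorem mul_mul_expands_distrib_distrib (a b c : W) :
    Expands ((a.mul b).mul (a.mul c)) (a.distrib (b.distrib c)) := by
  induction c with
  | one => exact .congr (expands_distrib _ _) (.refl _)
  | mul c d ihc ihd =>
    exact ((Expands.refl _).congr (.ld _ _ _)).trans ((Expands.ld _ _ _).trans (.congr ihc ihd))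

theorem derive_mono {a b : W} (h : Expands a b) : Expands a.derive b.derive := by
  induction h with
  | refl a => exact .refl _
  | trans _ _ ih₁ ih₂ => exact ih₁.trans ih₂
  | congr _ _ ih₁ ih₂ => exact (distrib_mono_left ih₁ _).trans (distrib_mono_right _ ih₂)
  | ld a b c => exact distrib_distrib _ _ _

theorem mul_mul_expands_derive (a b c : W) :
    Expands ((a.mul b).mul (a.mul c)) (a.mul (b.mul c)).derive :=
  (Expands.congr (.congr (expands_derive a) (expands_derive b))
    (.congr (expands_derive a) (expands_derive c))).trans (mul_mul_expands_distrib_distrib _ _ _)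

theorem iterate_derive_mono {a b : W} (h : Expands a b) (n : ℕ) :
    Expands (derive^[n] a) (derive^[n] b) := by
  induction n with
  | zero => exact h
  | succ n ih => simpa only [Function.iterate_succ_apply'] using derive_mono ih

theorem expands_iterate_derive (a : W) (n : ℕ) : Expands a (derive^[n] a) := by
  induction n with
  | zero => exact .refl a
  | succ n ih =>
    rw [Function.iterate_succ_apply']
    exact ih.trans (expands_derive _)

theorem iterate_derive_expands_of_le (a : W) {m n : ℕ} (h : m ≤ n) :
    Expands (derive^[m] a) (derive^[n] a) := by
  obtain ⟨k, rfl⟩ := Nat.exists_eq_add_of_le h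
  rw [Function.iterate_add_apply]
  exact iterate_derive_mono (expands_iterate_derive a k) m

theorem mul_iterate_derive_expands (a b : W) (n : ℕ) :
    Expands ((derive^[n] a).mul (derive^[n] b)) (derive^[n] (a.mul b)) := by
  induction n with
  | zero => exact .refl _
  | succ n ih =>
    simp only [Function.iterate_succ_apply']
    exact (expands_distrib _ _).trans (derive_mono ih)

theorem exists_expands_iterate_derive_trans {a b c : W}
    (hab : ∃ n, Expands a (derive^[n] b)) (hbc : ∃ n, Expands b (derive^[n] c)) :
    ∃ n, Expands a (derive^[n] c) := by
  obtain ⟨m, hm⟩ := hab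
  obtain ⟨n, hn⟩ := hbc
  refine ⟨m + n, hm.trans ?_⟩
  rw [Function.iterate_add_apply]
  exact iterate_derive_mono hn m

theorem exists_expands_iterate_derive_congr {a a' b b' : W}
    (ha : ∃ n, Expands a (derive^[n] a')) (hb : ∃ n, Expands b (derive^[n] b')) :
    ∃ n, Expands (a.mul b) (derive^[n] (a'.mul b')) := by
  obtain ⟨m, hm⟩ := ha
  obtain ⟨n, hn⟩ := hb
  exact ⟨max m n, (Expands.congr
    (hm.trans (iterate_derive_expands_of_le a' (le_max_left m n)))
    (hn.trans (iterate_derive_expands_of_le b' (le_max_right m n)))).trans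
    (mul_iterate_derive_expands a' b' _)⟩

theorem exists_expands_iterate_derive {a b : W} (h : LDEq a b) :
    (∃ n, Expands a (derive^[n] b)) ∧ ∃ n, Expands b (derive^[n] a) := by
  induction h with
  | refl a => exact ⟨⟨0, .refl a⟩, 0, .refl a⟩
  | symm _ ih => exact ih.symm
  | trans _ _ ih₁ ih₂ =>
    exact ⟨exists_expands_iterate_derive_trans ih₁.1 ih₂.1,
      exists_expands_iterate_derive_trans ih₂.2 ih₁.2⟩
  | congr _ _ ih₁ ih₂ =>
    exact ⟨exists_expands_iterate_derive_congr ih₁.1 ih₂.1,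
      exists_expands_iterate_derive_congr ih₁.2 ih₂.2⟩
  | ld a b c => exact ⟨⟨0, .ld a b c⟩, 1, mul_mul_expands_derive a b c⟩

/-- Confluence: equivalent words have a common expansion. -/
theorem exists_common_expansion {a b : W} (h : LDEq a b) :
    ∃ c, Expands a c ∧ Expands b c := by
  obtain ⟨n, hn⟩ := (exists_expands_iterate_derive h).1
  exact ⟨_, hn, expands_iterate_derive b n⟩

/-- Every word is absorbed by all sufficiently large right powers. -/
theorem exists_mul_rightPow (a : W) :
    ∃ N, ∀ n, N ≤ n → LDEq (a.mul (rightPow n)) (rightPow (n + 1)) := by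
  induction a with
  | one => exact ⟨0, fun n _ => .refl _⟩
  | mul a b iha ihb =>
    obtain ⟨M, hM⟩ := iha
    obtain ⟨N, hN⟩ := ihb
    refine ⟨max M N + 1, fun n hn => ?_⟩
    obtain ⟨k, rfl⟩ : ∃ k, n = k + 1 := ⟨n - 1, by omega⟩
    have hMk := hM k (by omega)
    have hb : LDEq ((a.mul b).mul (a.mul (rightPow k))) (a.mul (rightPow (k + 1))) :=
      (LDEq.ld a b _).symm.trans ((LDEq.refl a).congr (hN k (by omega)))
    exact ((LDEq.refl _).congr hMk.symm).trans (hb.trans (hM (k + 1) (by omega)))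

theorem LeftSub.total {a b c : W} (ha : LeftSub a c) (hb : LeftSub b c) :
    LeftSub a b ∨ LeftSub b a := by
  induction ha with
  | refl => exact .inr hb
  | mul d ha ih =>
    cases hb with
    | refl => exact .inl (ha.mul d)
    | mul _ hb => exact ih hb

theorem LeftSub.exists_foldl {a b : W} (h : LeftSub a b) : ∃ l : List W, l.foldl W.mul a = b := by
  induction h with
  | refl => exact ⟨[], rfl⟩
  | mul c _ ih =>
    obtain ⟨l, rfl⟩ := ih
    exact ⟨l ++ [c], by simp⟩

/-- Expanding a word expands each of its iterated left subwords into an iterated left subword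
of the result. -/
theorem LeftSub.exists_of_expands {a t t' : W} (h : LeftSub a t) (ht : Expands t t') :
    ∃ a', Expands a a' ∧ LeftSub a' t' := by
  induction ht generalizing a with
  | refl t => exact ⟨a, .refl a, h⟩
  | trans _ _ ih₁ ih₂ =>
    obtain ⟨b, hab, hb⟩ := ih₁ h
    obtain ⟨c, hbc, hc⟩ := ih₂ hb
    exact ⟨c, hab.trans hbc, hc⟩
  | congr hs ht ih₁ _ =>
    cases h with
    | refl => exact ⟨_, hs.congr ht, .refl⟩
    | mul _ h =>
      obtain ⟨b, hab, hb⟩ := ih₁ h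
      exact ⟨b, hab, hb.mul _⟩
  | ld b c d =>
    cases h with
    | refl => exact ⟨_, .ld b c d, .refl⟩
    | mul _ h => exact ⟨a, .refl a, (h.mul c).mul _⟩

end W

theorem LDEq.foldl_mul {a b : W} (h : LDEq a b) (l : List W) :
    LDEq (l.foldl W.mul a) (l.foldl W.mul b) := by
  induction l generalizing a b with
  | nil => exact h
  | cons c l ih => exact ih (h.congr (.refl c))

/-- Words with expansions related by `W.LeftSub` are equivalent or comparable. -/
theorem ldEq_or_exists_foldl_mul {a b a' b' : W} (ha : LDEq a a') (hb : LDEq b b')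
    (h : W.LeftSub a' b') :
    LDEq a b ∨ ∃ l : List W, l ≠ [] ∧ LDEq (l.foldl W.mul a) b := by
  obtain ⟨l, rfl⟩ := h.exists_foldl
  have hl := (ha.foldl_mul l).trans hb.symm
  rcases eq_or_ne l [] with rfl | hne
  · exact .inl hl
  · exact .inr ⟨l, hne, hl⟩

theorem stmt_1 (a b : W) :
    LDEq a b ∨
    (∃ l : List W, l ≠ [] ∧ LDEq (l.foldl W.mul a) b) ∨
    (∃ l : List W, l ≠ [] ∧ LDEq (l.foldl W.mul b) a) := by
  obtain ⟨M, hM⟩ := W.exists_mul_rightPow a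
  obtain ⟨N, hN⟩ := W.exists_mul_rightPow b
  obtain ⟨c, hac, hbc⟩ := W.exists_common_expansion
    ((hM _ (le_max_left M N)).trans (hN _ (le_max_right M N)).symm)
  obtain ⟨a', ha, ha'⟩ := (W.LeftSub.refl.mul _).exists_of_expands hac
  obtain ⟨b', hb, hb'⟩ := (W.LeftSub.refl.mul _).exists_of_expands hbc
  rcases ha'.total hb' with h | h
  · rcases ldEq_or_exists_foldl_mul ha.ldEq hb.ldEq h with h | h
    · exact .inl h
    · exact .inr (.inl h)
  · rcases ldEq_or_exists_foldl_mul hb.ldEq ha.ldEq h with h | h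
    · exact .inl h.symm
    · exact .inr (.inr h)
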